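/- Let p₁, ..., p_N be polynomials in N variables over an algebraically closed field such that the set of common zeros is finite. Then the number of common zeros is at most the product of the degrees d₁·d₂·⋯·d_N. -/

import Mathlib

namespace BezoutBound

open MvPolynomial

/-- An `F`-finite subspace of an `F[X]`-module that is stable under `X` is killed by a nonzero
polynomial. -/
theorem exists_ne_zero_smul_eq_zero {F Q : Type*} [Field F] [AddCommGroup Q] [Module F Q]
    [Module (Polynomial F) Q] [IsScalarTower F (Polynomial F) Q] (W : Submodule F Q) (hW : W.FG)
    (h : ∀ w ∈ W, (Polynomial.X : Polynomial F) • w ∈ W) :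
    ∃ f : Polynomial F, f ≠ 0 ∧ ∀ w ∈ W, f • w = 0 := by
  have : Module.Finite F W := Module.Finite.iff_fg.mpr hW
  let T : Module.End F W := (Algebra.lsmul F F Q (Polynomial.X : Polynomial F)).restrict h
  have hT (w : W) : (T w : Q) = (Polynomial.X : Polynomial F) • (w : Q) := rfl
  have key (f : Polynomial F) (w : W) : (Polynomial.aeval T f w : Q) = f • (w : Q) := by
    induction f using Polynomial.induction_on generalizing w with
    | C a =>
      rw [← mul_one (Polynomial.C a), ← Polynomial.smul_eq_C_mul, smul_assoc, one_smul]
      simp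
    | add p q hp hq => simp [hp, hq, add_smul]
    | monomial n a ih =>
      rw [pow_succ, ← mul_assoc, map_mul, Module.End.mul_apply, ih, Polynomial.aeval_X, hT,
        ← mul_smul]
  refine ⟨minpoly F T, minpoly.ne_zero (Algebra.IsIntegral.isIntegral T), fun w hw ↦ ?_⟩
  simpa using (key (minpoly F T) ⟨w, hw⟩).symm

/-- Equidimensionality of polynomial rings over an equidimensional Noetherian Jacobson ring. -/
theorem height_eq_of_isMaximal {R : Type*} [CommRing R] [IsNoetherianRing R] [IsJacobsonRing R]
    (h : ℕ∞) (hR : ∀ M : Ideal R, M.IsMaximal → M.height = h) (n : ℕ)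
    (M : Ideal (MvPolynomial (Fin n) R)) (hM : M.IsMaximal) : M.height = h + n := by
  induction n with
  | zero =>
    let e := (MvPolynomial.isEmptyRingEquiv R (Fin 0)).symm
    rw [← RingEquiv.height_comap e, hR _ (Ideal.comap_isMaximal_of_equiv e)]
    simp
  | succ n ih =>
    let e := (MvPolynomial.finSuccEquiv R n).symm.toRingEquiv
    rw [← RingEquiv.height_comap e]
    have hP : (M.comap e).IsMaximal := Ideal.comap_isMaximal_of_equiv e
    have hp := Polynomial.isMaximal_comap_C_of_isJacobsonRing (M.comap e)
    have : (M.comap e).LiesOver ((M.comap e).comap Polynomial.C) := ⟨rfl⟩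
    rw [Polynomial.height_eq_height_add_one ((M.comap e).comap Polynomial.C), ih _ hp]
    push_cast
    ring

variable {F : Type*} [Field F] {N : ℕ}

/-- The one-parameter deformation `t * xᵢ ^ dᵢ + pᵢ` of the system `p`, with `dᵢ = deg pᵢ`. -/
noncomputable def deformation (p : Fin N → MvPolynomial (Fin N) F) (i : Fin N) :
    MvPolynomial (Fin N) (Polynomial F) :=
  C Polynomial.X * X i ^ (p i).totalDegree + map Polynomial.C (p i)

/-- Evaluation at the parameter value `0` and the point `a`. -/
noncomputable def evalZero (a : Fin N → F) : MvPolynomial (Fin N) (Polynomial F) →+* F :=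
  eval₂Hom (Polynomial.evalRingHom 0) a

@[simp]
theorem evalZero_C (a : Fin N → F) (f : Polynomial F) : evalZero a (C f) = f.eval 0 := by
  simp [evalZero]

@[simp]
theorem evalZero_map (a : Fin N → F) (g : MvPolynomial (Fin N) F) :
    evalZero a (map Polynomial.C g) = eval a g := by
  have : (Polynomial.evalRingHom 0).comp Polynomial.C = RingHom.id F := by ext; simp
  rw [evalZero, eval₂Hom_map_hom, this]
  rfl

theorem evalZero_surjective (a : Fin N → F) : Function.Surjective (evalZero a) :=
  fun c ↦ ⟨C (Polynomial.C c), by simp⟩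

theorem ker_evalZero_le (a : Fin N → F) (P : Ideal (MvPolynomial (Fin N) (Polynomial F)))
    (hX : C Polynomial.X ∈ P) (ha : ∀ i, map Polynomial.C (X i - C (a i)) ∈ P) :
    RingHom.ker (evalZero a) ≤ P := by
  have key : (Ideal.Quotient.mk P) =
      ((Ideal.Quotient.mk P).comp (C.comp Polynomial.C)).comp (evalZero a) := by
    apply MvPolynomial.ringHom_ext'
    · apply Polynomial.ringHom_ext
      · intro c; simp
      · simpa [Ideal.Quotient.eq_zero_iff_mem] using hX
    · intro i
      have := ha i
      rw [map_sub, map_X, map_C] at this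
      simpa [evalZero] using (Ideal.Quotient.eq.mpr this)
  intro g hg
  rw [RingHom.mem_ker] at hg
  rw [← Ideal.Quotient.eq_zero_iff_mem, key, RingHom.comp_apply, hg, map_zero]

/-- A prime of `F[x]` contained in the maximal ideal of `a`, whose zero locus is finite,
contains the maximal ideal of `a`. -/
theorem X_sub_C_mem_of_finite_zeroLocus [IsAlgClosed F] (P : Ideal (MvPolynomial (Fin N) F))
    [hP : P.IsPrime] (hfin : (zeroLocus F P).Finite) (a : Fin N → F)
    (ha : ∀ g ∈ P, eval a g = 0) (i : Fin N) : X i - C (a i) ∈ P := by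
  have hmem : ∏ b ∈ hfin.toFinset, (X i - C (b i)) ∈ P := by
    refine hP.radical.le ?_
    rw [← vanishingIdeal_zeroLocus_eq_radical (K := F), mem_vanishingIdeal_iff]
    intro x hx
    rw [map_prod]
    exact Finset.prod_eq_zero (hfin.mem_toFinset.mpr hx) (by simp)
  obtain ⟨b, -, hb⟩ := Ideal.IsPrime.prod_mem_iff.mp hmem
  have := ha _ hb
  simp only [map_sub, eval_X, eval_C, sub_eq_zero] at this
  rwa [this]

/-- Through each zero of a system with finitely many zeros passes a component of the deformation
not contained in the fibre at parameter `0`. -/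
theorem exists_isPrime_of_zero [IsAlgClosed F] (p : Fin N → MvPolynomial (Fin N) F)
    (hfin : {x : Fin N → F | ∀ i, eval x (p i) = 0}.Finite) (a : Fin N → F)
    (ha : ∀ i, eval a (p i) = 0) :
    ∃ P : Ideal (MvPolynomial (Fin N) (Polynomial F)), P.IsPrime ∧
      (∀ i, deformation p i ∈ P) ∧ P ≤ RingHom.ker (evalZero a) ∧ C Polynomial.X ∉ P := by
  have hmax : (RingHom.ker (evalZero a)).IsMaximal :=
    RingHom.ker_isMaximal_of_surjective _ (evalZero_surjective a)
  have hle : Ideal.span (Set.range (deformation p)) ≤ RingHom.ker (evalZero a) := by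
    rw [Ideal.span_le]
    rintro _ ⟨i, rfl⟩
    simp [deformation, RingHom.mem_ker, ha]
  obtain ⟨P, hPmin, hPle⟩ := Ideal.exists_minimalPrimes_le hle
  have hP : P.IsPrime := hPmin.1.1
  have hq (i) : deformation p i ∈ P := hPmin.1.2 (Ideal.subset_span ⟨i, rfl⟩)
  refine ⟨P, hP, hq, hPle, fun hX ↦ ?_⟩
  have hp (i) : map Polynomial.C (p i) ∈ P :=
    (Ideal.add_mem_iff_right P (P.mul_mem_right _ hX)).mp (hq i)
  have hfin' : (zeroLocus F (P.comap (map Polynomial.C))).Finite :=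
    hfin.subset fun x hx i ↦ by simpa [aeval_eq_eval] using hx _ (hp i)
  have heq : P = RingHom.ker (evalZero a) := le_antisymm hPle <| ker_evalZero_le a P hX <|
    X_sub_C_mem_of_finite_zeroLocus (P.comap (map Polynomial.C)) hfin' a
      fun g hg ↦ by simpa [RingHom.mem_ker] using hPle hg
  have hupper := Ideal.height_le_card_of_mem_minimalPrimes_span (Set.finite_range _) hPmin
  have hcard : (Set.range (deformation p)).ncard ≤ N := by
    simpa [Set.image_univ] using Set.ncard_image_le (f := deformation p) Set.finite_univ
  rw [heq, height_eq_of_isMaximal 1 (fun M hM ↦ IsPrincipalIdealRing.height_eq_one_of_isMaximal M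
    (Polynomial.not_isField F)) N _ hmax] at hupper
  have : ((1 + N : ℕ) : ℕ∞) ≤ (N : ℕ) := by
    push_cast
    exact hupper.trans (by exact_mod_cast hcard)
  have := Nat.cast_le.mp this
  omega

/-- A prime contained in the maximal ideal of `(0, a)` and not containing the parameter `t`
contains no nonzero polynomial in `t`. -/
theorem C_notMem_of_ne_zero (P : Ideal (MvPolynomial (Fin N) (Polynomial F))) (hP : P.IsPrime)
    (a : Fin N → F) (hle : P ≤ RingHom.ker (evalZero a)) (hX : C Polynomial.X ∉ P)
    (f : Polynomial F) (hf : f ≠ 0) : C f ∉ P := by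
  intro h
  obtain ⟨g, hg, hdvd⟩ := Polynomial.exists_eq_pow_rootMultiplicity_mul_and_not_dvd f hf 0
  simp only [map_zero, sub_zero] at hg hdvd
  rw [hg, map_mul, map_pow] at h
  rcases hP.mem_or_mem h with h | h
  · exact hX (hP.mem_of_pow_mem _ h)
  · have := hle h
    rw [RingHom.mem_ker, evalZero_C, ← Polynomial.coeff_zero_eq_eval_zero] at this
    exact hdvd (Polynomial.X_dvd_iff.mpr this)

/-- Polynomials separating the points of a finite set. -/
theorem exists_separating {S : Type*} [Finite S] (x : S → Fin N → F)
    (hx : Function.Injective x) (s : S) :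
    ∃ e : MvPolynomial (Fin N) F, eval (x s) e ≠ 0 ∧ ∀ r ≠ s, eval (x r) e = 0 := by
  classical
  have := Fintype.ofFinite S
  have hne (r : S) : ∃ g : MvPolynomial (Fin N) F,
      eval (x r) g = 0 ∧ (r ≠ s → eval (x s) g ≠ 0) := by
    by_cases hr : r = s
    · exact ⟨0, by simp, fun h ↦ absurd hr h⟩
    · obtain ⟨i, hi⟩ := Function.ne_iff.mp (hx.ne hr)
      exact ⟨X i - C (x r i), by simp, fun _ ↦ by simpa [sub_eq_zero] using hi.symm⟩
  choose g hg hgs using hne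
  refine ⟨∏ r ∈ Finset.univ.erase s, g r, ?_, fun r hr ↦ ?_⟩
  · rw [map_prod]
    exact Finset.prod_ne_zero_iff.mpr fun r hr ↦ hgs r (Finset.ne_of_mem_erase hr)
  · rw [map_prod]
    exact Finset.prod_eq_zero (i := r) (by simp [hr]) (hg r)

/-- The monomials with all exponents below the degrees of the system. -/
noncomputable def standardMonomials (p : Fin N → MvPolynomial (Fin N) F) :
    Finset (MvPolynomial (Fin N) (Polynomial F)) := by
  classical
  exact (Fintype.piFinset fun i ↦ Finset.range (p i).totalDegree).image
    fun α ↦ monomial (Finsupp.equivFunOnFinite.symm α) 1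

theorem card_standardMonomials_le (p : Fin N → MvPolynomial (Fin N) F) :
    (standardMonomials p).card ≤ ∏ i, (p i).totalDegree := by
  classical
  exact Finset.card_image_le.trans (by simp)

theorem monomial_mem_standardMonomials (p : Fin N → MvPolynomial (Fin N) F) (α : Fin N →₀ ℕ)
    (h : ∀ i, α i < (p i).totalDegree) : monomial α 1 ∈ standardMonomials p := by
  classical
  refine Finset.mem_image.mpr ⟨α, by simpa using h, ?_⟩
  congr 1
  ext; simp

/-- Up to a nonzero polynomial in the parameter, every polynomial is congruent to a combination of
standard monomials modulo the deformed system. -/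
theorem exists_ne_zero_smul_mem (p : Fin N → MvPolynomial (Fin N) F)
    (J : Ideal (MvPolynomial (Fin N) (Polynomial F))) (hJ : ∀ i, deformation p i ∈ J)
    (g : MvPolynomial (Fin N) F) :
    ∃ f : Polynomial F, f ≠ 0 ∧ f • map Polynomial.C g ∈
      Submodule.span (Polynomial F) (standardMonomials p : Set _) ⊔
        J.restrictScalars (Polynomial F) := by
  set K := Submodule.span (Polynomial F) (standardMonomials p : Set _) ⊔
    J.restrictScalars (Polynomial F)
  set D := g.totalDegree
  let v : (Fin N →₀ ℕ) → MvPolynomial (Fin N) (Polynomial F) ⧸ K :=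
    fun α ↦ K.mkQ (monomial α 1)
  let W : Submodule F (MvPolynomial (Fin N) (Polynomial F) ⧸ K) :=
    Submodule.span F (v '' {α | α.degree ≤ D})
  have hmem (h : MvPolynomial (Fin N) F) (hh : h.totalDegree ≤ D) :
      K.mkQ (map Polynomial.C h) ∈ W := by
    rw [h.as_sum, map_sum, map_sum]
    refine Submodule.sum_mem _ fun α hα ↦ ?_
    have : map Polynomial.C (monomial α (coeff α h)) =
        (Polynomial.C (coeff α h)) • (monomial α (1 : Polynomial F)) := by
      rw [map_monomial, smul_monomial, smul_eq_mul, mul_one]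
    rw [this, map_smul, ← mul_one (Polynomial.C _), ← Polynomial.smul_eq_C_mul, smul_assoc,
      one_smul]
    exact W.smul_mem _ (Submodule.subset_span ⟨α, (le_totalDegree hα).trans hh, rfl⟩)
  have hstable (w) (hw : w ∈ W) : (Polynomial.X : Polynomial F) • w ∈ W := by
    induction hw using Submodule.span_induction with
    | zero => simp
    | add x y _ _ hx hy => rw [smul_add]; exact W.add_mem hx hy
    | smul c x _ hx => rw [smul_comm]; exact W.smul_mem c hx
    | mem x hx =>
      obtain ⟨α, hα, rfl⟩ := hx
      by_cases hstd : ∀ i, α i < (p i).totalDegree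
      · have : v α = 0 := (Submodule.Quotient.mk_eq_zero K).mpr <|
          Submodule.mem_sup_left (Submodule.subset_span (monomial_mem_standardMonomials p α hstd))
        simp [this]
      · push Not at hstd
        obtain ⟨i, hi⟩ := hstd
        obtain ⟨β, rfl⟩ : ∃ β, α = β + Finsupp.single i (p i).totalDegree :=
          ⟨α - Finsupp.single i (p i).totalDegree, by
            rw [tsub_add_cancel_of_le (Finsupp.single_le_iff.mpr hi)]⟩
        have hmon : (monomial (β + Finsupp.single i (p i).totalDegree) (1 : Polynomial F)) =
            monomial β 1 * X i ^ (p i).totalDegree := by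
          rw [X_pow_eq_monomial, monomial_mul, one_mul]
        have hsplit : (Polynomial.X : Polynomial F) •
            (monomial (β + Finsupp.single i (p i).totalDegree) (1 : Polynomial F)) =
            monomial β 1 * deformation p i - map Polynomial.C (monomial β 1 * p i) := by
          rw [hmon, smul_eq_C_mul, deformation, map_mul, map_monomial,
            Polynomial.C_1]
          ring
        have hz : K.mkQ (monomial β 1 * deformation p i) = 0 :=
          (Submodule.Quotient.mk_eq_zero K).mpr
            (Submodule.mem_sup_right (J.mul_mem_left _ (hJ i)))
        rw [← map_smul, hsplit, map_sub, hz, zero_sub]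
        refine W.neg_mem (hmem _ ?_)
        refine (totalDegree_mul _ _).trans ?_
        rw [totalDegree_monomial _ one_ne_zero]
        have hα' : (β + Finsupp.single i (p i).totalDegree).degree ≤ D := hα
        rw [map_add, Finsupp.degree_single] at hα'
        exact hα'
  obtain ⟨f, hf, hfW⟩ := exists_ne_zero_smul_eq_zero W
    (Submodule.fg_span ((Finsupp.finite_of_degree_le D).image v)) hstable
  refine ⟨f, hf, (Submodule.Quotient.mk_eq_zero K).mp ?_⟩
  exact hfW _ (hmem g le_rfl)

end BezoutBound

/-- Bezout bound: a square polynomial system with finitely many common zeros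
has at most `∏ deg pᵢ` of them. -/
theorem bezout_bound {F : Type*} [Field F] [IsAlgClosed F]
    (N : ℕ) (p : Fin N → MvPolynomial (Fin N) F)
    (hfin : {x : Fin N → F | ∀ i, MvPolynomial.eval x (p i) = 0}.Finite) :
    {x : Fin N → F | ∀ i, MvPolynomial.eval x (p i) = 0}.ncard ≤
      ∏ i, (p i).totalDegree := by
  classical
  open BezoutBound MvPolynomial in
  set S := {x : Fin N → F | ∀ i, eval x (p i) = 0}
  have : Fintype S := hfin.fintype
  choose P hP hdef hle hX using fun a : S ↦ exists_isPrime_of_zero p hfin a a.2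
  choose e he he' using exists_separating (fun a : S ↦ (a : Fin N → F)) Subtype.val_injective
  let J := ⨅ a, P a
  have hJ (i) : deformation p i ∈ J := (Submodule.mem_iInf P).mpr fun a ↦ hdef a i
  choose f hf hfmem using fun a ↦ exists_ne_zero_smul_mem p J hJ (e a)
  -- modulo `J`, the parameter is a nonzerodivisor and relations vanish at parameter `0`
  have hdvd (n : ℕ) : ∀ c : S → Polynomial F,
      ∑ a, C (c a) * map Polynomial.C (e a) ∈ J → ∀ a, Polynomial.X ^ n ∣ c a := by
    induction n with
    | zero => simp
    | succ n ih =>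
      intro c hc
      have hzero (a : S) : Polynomial.X ∣ c a := by
        have h := hle a ((Submodule.mem_iInf P).mp hc a)
        rw [RingHom.mem_ker, map_sum, Finset.sum_eq_single a
          (fun b _ hb ↦ by simp [he' b a hb.symm]) (by simp)] at h
        simp only [map_mul, evalZero_C, evalZero_map, mul_eq_zero, he a, or_false] at h
        rwa [Polynomial.X_dvd_iff, Polynomial.coeff_zero_eq_eval_zero]
      choose c' hc' using hzero
      have hc'J : ∑ a, C (c' a) * map Polynomial.C (e a) ∈ J := by
        refine (Submodule.mem_iInf P).mpr fun b ↦ ?_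
        have h : C Polynomial.X * ∑ a, C (c' a) * map Polynomial.C (e a) ∈ P b := by
          rw [Finset.mul_sum]
          simp only [← mul_assoc, ← map_mul, ← hc']
          exact (Submodule.mem_iInf P).mp hc b
        exact ((hP b).mem_or_mem h).resolve_left (hX b)
      intro a
      rw [hc' a, pow_succ']
      exact mul_dvd_mul_left _ (ih c' hc'J a)
  let w : S → MvPolynomial (Fin N) (Polynomial F) ⧸ J.restrictScalars (Polynomial F) :=
    fun a ↦ (J.restrictScalars (Polynomial F)).mkQ (f a • map Polynomial.C (e a))
  have hw : LinearIndependent (Polynomial F) w := by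
    rw [Fintype.linearIndependent_iff]
    intro c hc a
    have hcJ : ∑ a, C (c a * f a) * map Polynomial.C (e a) ∈ J := by
      simp only [w, ← map_smul, ← map_sum] at hc
      have := (Submodule.Quotient.mk_eq_zero _).mp hc
      simpa only [Submodule.restrictScalars_mem, smul_eq_C_mul, ← mul_assoc, ← map_mul] using this
    by_contra hca
    have hne := mul_ne_zero hca (hf a)
    have := Polynomial.natDegree_le_of_dvd (hdvd ((c a * f a).natDegree + 1) _ hcJ a) hne
    simp at this
  let std := (standardMonomials p).image (J.restrictScalars (Polynomial F)).mkQ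
  have hspan (a : S) : w a ∈ Submodule.span (Polynomial F) (std : Set
      (MvPolynomial (Fin N) (Polynomial F) ⧸ J.restrictScalars (Polynomial F))) := by
    obtain ⟨s, hs, j, hj, hsj⟩ := Submodule.mem_sup.mp (hfmem a)
    have hj0 : (J.restrictScalars (Polynomial F)).mkQ j = 0 :=
      (Submodule.Quotient.mk_eq_zero _).mpr hj
    rw [Finset.coe_image, ← Submodule.map_span]
    exact ⟨s, hs, by simp only [w, ← hsj, map_add, hj0, add_zero]⟩
  have hcard := linearIndependent_le_span' w hw _ (Set.range_subset_iff.mpr hspan)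
  rw [Cardinal.mk_fintype, Nat.cast_le] at hcard
  replace hcard : Fintype.card S ≤ std.card := hcard.trans_eq (by simp)
  rw [← Nat.card_coe_set_eq, Nat.card_eq_fintype_card]
  exact hcard.trans (Finset.card_image_le.trans (card_standardMonomials_le p))
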